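/- arXiv:2407.09878 — 2 statements merged into one kernel-verified Lean document; each statement's English description precedes it below -/
import Mathlib

section
/- Let P ⊂ ℝ² be an integer polygon. Then the centered random variable X_P − E[X_P] has a symmetric distribution: X_P − E[X_P] and −(X_P − E[X_P]) have the same distribution. -/
open MeasureTheory

noncomputable section

/-- The embedding of `ℤ²` into `ℝ²`. -/
def toR2 (m : ℤ × ℤ) : ℝ × ℝ := ((m.1 : ℝ), (m.2 : ℝ))

/-- The cross product of two integer vectors. -/
def zcross (v w : ℤ × ℤ) : ℤ := v.1 * w.2 - v.2 * w.1

/-- `latCount C x = |(C + x) ∩ ℤ²|`, the number of lattice points in the translate `C + x`. -/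
def latCount (C : Set (ℝ × ℝ)) (x : ℝ × ℝ) : ℕ :=
  Set.ncard {m : ℤ × ℤ | toR2 m - x ∈ C}

/-- The uniform distribution on the unit square `[0,1]²`. -/
def μunit : Measure (ℝ × ℝ) := volume.restrict (Set.Icc (0 : ℝ × ℝ) 1)

open Set Filter

/-! ### Lattice counts outside null sets -/

theorem toR2_injective : Function.Injective toR2 := by
  rintro ⟨a, b⟩ ⟨c, d⟩ h
  simpa [toR2] using h

theorem toR2_add (m k : ℤ × ℤ) : toR2 (m + k) = toR2 m + toR2 k := by
  simp [toR2]

theorem toR2_sub (m k : ℤ × ℤ) : toR2 (m - k) = toR2 m - toR2 k := by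
  simp [toR2]

theorem latCount_sub_toR2 (A : Set (ℝ × ℝ)) (k : ℤ × ℤ) (x : ℝ × ℝ) :
    latCount A (toR2 k - x) = latCount A (-x) := by
  unfold latCount
  rw [← Set.ncard_image_of_injective {m : ℤ × ℤ | toR2 m - -x ∈ A} (add_left_injective k)]
  congr 1
  ext m
  simp only [Set.mem_ofPred_eq, Set.mem_image]
  constructor
  · intro h
    refine ⟨m - k, ?_, by abel⟩
    rw [toR2_sub]
    convert h using 1
    abel
  · rintro ⟨m, h, rfl⟩
    rw [toR2_add]
    convert h using 1
    abel

/-- Reflecting a set in a half-integral point amounts to negating the translation vector. -/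
theorem latCount_neg (A : Set (ℝ × ℝ)) (k : ℤ × ℤ) (x : ℝ × ℝ) :
    latCount A (-x) = latCount {z | toR2 k - z ∈ A} x := by
  unfold latCount
  rw [← Set.ncard_image_of_injective {m : ℤ × ℤ | toR2 m - -x ∈ A} (sub_right_injective (b := k))]
  congr 1
  ext m
  simp only [Set.mem_ofPred_eq, Set.mem_image]
  constructor
  · rintro ⟨m, h, rfl⟩
    rw [toR2_sub]
    convert h using 1
    abel
  · intro h
    refine ⟨k - m, ?_, by abel⟩
    rw [toR2_sub]
    convert h using 1
    abel

theorem finite_latticePoints {A : Set (ℝ × ℝ)} (hA : Bornology.IsBounded A) (x : ℝ × ℝ) :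
    {m : ℤ × ℤ | toR2 m - x ∈ A}.Finite := by
  obtain ⟨r, hr⟩ := hA.subset_closedBall x
  refine (((Set.finite_Icc ⌊2 * x.1 - r⌋ ⌈2 * x.1 + r⌉).prod
    (Set.finite_Icc ⌊2 * x.2 - r⌋ ⌈2 * x.2 + r⌉))).subset ?_
  intro m hm
  have h := hr hm
  rw [mem_closedBall_iff_norm, Prod.norm_def, max_le_iff, Real.norm_eq_abs, Real.norm_eq_abs,
    abs_le, abs_le] at h
  simp only [toR2, Prod.fst_sub, Prod.snd_sub] at h
  obtain ⟨⟨h1, h2⟩, h3, h4⟩ := h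
  refine ⟨⟨?_, ?_⟩, ?_, ?_⟩
  · exact_mod_cast (Int.floor_le (2 * x.1 - r)).trans (by linarith : _ ≤ (m.1 : ℝ))
  · exact_mod_cast (by linarith : (m.1 : ℝ) ≤ 2 * x.1 + r).trans (Int.le_ceil _)
  · exact_mod_cast (Int.floor_le (2 * x.2 - r)).trans (by linarith : _ ≤ (m.2 : ℝ))
  · exact_mod_cast (by linarith : (m.2 : ℝ) ≤ 2 * x.2 + r).trans (Int.le_ceil _)

theorem measurePreserving_sub_left_R2 (v : ℝ × ℝ) :
    MeasurePreserving (fun x : ℝ × ℝ => v - x) :=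
  Measure.measurePreserving_sub_left volume v

theorem ae_forall_toR2_sub_notMem {N : Set (ℝ × ℝ)} (hN : volume N = 0) :
    ∀ᵐ x : ℝ × ℝ, ∀ m : ℤ × ℤ, toR2 m - x ∉ N := by
  rw [ae_all_iff]
  intro m
  exact (measurePreserving_sub_left_R2 (toR2 m)).quasiMeasurePreserving.ae
    (measure_eq_zero_iff_ae_notMem.1 hN)

theorem ae_latCount_union {A B N : Set (ℝ × ℝ)} (hA : Bornology.IsBounded A)
    (hB : Bornology.IsBounded B) (hN : volume N = 0) (hAB : A ∩ B ⊆ N) :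
    ∀ᵐ x : ℝ × ℝ, latCount (A ∪ B) x = latCount A x + latCount B x := by
  filter_upwards [ae_forall_toR2_sub_notMem hN] with x hx
  unfold latCount
  rw [← Set.ncard_union_eq _ (finite_latticePoints hA x) (finite_latticePoints hB x)]
  · rfl
  · exact Set.disjoint_left.2 fun m h1 h2 => hx m (hAB ⟨h1, h2⟩)

theorem volume_line {p q : ℝ} (r : ℝ) (h : p ≠ 0 ∨ q ≠ 0) :
    volume {z : ℝ × ℝ | p * z.1 + q * z.2 = r} = 0 := by
  have hm : MeasurableSet {z : ℝ × ℝ | p * z.1 + q * z.2 = r} :=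
    measurableSet_eq_fun (by fun_prop) (by fun_prop)
  rw [Measure.volume_eq_prod, Measure.measure_prod_null hm]
  by_cases hq : q = 0
  · have hp : p ≠ 0 := h.resolve_right (not_not.2 hq)
    filter_upwards [measure_eq_zero_iff_ae_notMem.1 (measure_singleton (μ := volume) (r / p))]
      with x hx
    have : Prod.mk x ⁻¹' {z : ℝ × ℝ | p * z.1 + q * z.2 = r} = ∅ := by
      refine Set.eq_empty_of_forall_notMem fun y hy => hx ?_
      simp only [hq, Set.mem_preimage, Set.mem_ofPred_eq, zero_mul, add_zero] at hy
      rw [Set.mem_singleton_iff, eq_div_iff hp, mul_comm, hy]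
    simp [this]
  · refine Eventually.of_forall fun x => ?_
    refine measure_mono_null ?_ (measure_singleton ((r - p * x) / q))
    intro y hy
    simp only [Set.mem_preimage, Set.mem_ofPred_eq] at hy
    rw [Set.mem_singleton_iff, eq_div_iff hq]
    linarith

/-! ### The signed distance to the line through two lattice points -/

/-- Twice the signed area of the triangle with vertices `p`, `q`, `z`. -/
def lineForm (p q : ℤ × ℤ) (z : ℝ × ℝ) : ℝ :=
  ((q.1 : ℝ) - p.1) * (z.2 - p.2) - ((q.2 : ℝ) - p.2) * (z.1 - p.1)

theorem lineForm_combo (p q : ℤ × ℤ) (u w : ℝ × ℝ) {s t : ℝ} (h : s + t = 1) :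
    lineForm p q (s • u + t • w) = s * lineForm p q u + t * lineForm p q w := by
  obtain rfl : s = 1 - t := by linarith
  simp only [lineForm, Prod.fst_add, Prod.snd_add, Prod.smul_fst, Prod.smul_snd, smul_eq_mul]
  ring

theorem volume_lineForm_eq {p q : ℤ × ℤ} (h : p ≠ q) (r : ℝ) :
    volume {z | lineForm p q z = r} = 0 := by
  have h' : -((q.2 : ℝ) - p.2) ≠ 0 ∨ (q.1 : ℝ) - p.1 ≠ 0 := by
    by_contra! hc
    refine h (Prod.ext ?_ ?_)
    · exact_mod_cast (sub_eq_zero.1 hc.2).symm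
    · exact_mod_cast (sub_eq_zero.1 (neg_eq_zero.1 hc.1)).symm
  refine measure_mono_null ?_
    (volume_line (r + ((q.1 : ℝ) - p.1) * p.2 - ((q.2 : ℝ) - p.2) * p.1) h')
  intro z hz
  simp only [Set.mem_ofPred_eq, lineForm] at hz ⊢
  linarith

theorem convex_lineForm_nonneg (p q : ℤ × ℤ) : Convex ℝ {z | 0 ≤ lineForm p q z} := by
  intro u hu w hw s t hs ht hst
  simp only [Set.mem_ofPred_eq] at *
  rw [lineForm_combo p q u w hst]
  positivity

theorem convex_lineForm_nonpos (p q : ℤ × ℤ) : Convex ℝ {z | lineForm p q z ≤ 0} := by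
  intro u hu w hw s t hs ht hst
  simp only [Set.mem_ofPred_eq] at *
  rw [lineForm_combo p q u w hst]
  nlinarith [mul_nonneg hs (neg_nonneg.2 hu), mul_nonneg ht (neg_nonneg.2 hw)]

theorem exists_eq_lineMap_of_lineForm_eq_zero {p q : ℤ × ℤ} (h : p ≠ q) {z : ℝ × ℝ}
    (hz : lineForm p q z = 0) : ∃ t : ℝ, z = AffineMap.lineMap (toR2 p) (toR2 q) t := by
  simp only [lineForm] at hz
  by_cases h1 : (q.1 : ℝ) - p.1 = 0
  · have h2 : (q.2 : ℝ) - p.2 ≠ 0 := fun h2 => h (Prod.ext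
      (by exact_mod_cast (sub_eq_zero.1 h1).symm) (by exact_mod_cast (sub_eq_zero.1 h2).symm))
    refine ⟨(z.2 - p.2) / ((q.2 : ℝ) - p.2), ?_⟩
    rw [h1] at hz
    have h3 : z.1 - p.1 = 0 := by
      rcases mul_eq_zero.1 (by linarith : ((q.2 : ℝ) - p.2) * (z.1 - p.1) = 0) with h | h
      · exact absurd h h2
      · exact h
    ext
    · simp [AffineMap.lineMap_apply, toR2, h1]
      linarith
    · simp [AffineMap.lineMap_apply, toR2]
      field_simp
      ring
  · refine ⟨(z.1 - p.1) / ((q.1 : ℝ) - p.1), ?_⟩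
    ext
    · simp [AffineMap.lineMap_apply, toR2]
      field_simp
      ring
    · simp [AffineMap.lineMap_apply, toR2]
      field_simp
      linarith

theorem mem_segment_of_lineForm_eq_zero {C : Set (ℝ × ℝ)} {p q : ℤ × ℤ} (h : p ≠ q)
    (hp : toR2 p ∈ C.extremePoints ℝ) (hq : toR2 q ∈ C.extremePoints ℝ) {z : ℝ × ℝ}
    (hzC : z ∈ C) (hz : lineForm p q z = 0) : z ∈ segment ℝ (toR2 p) (toR2 q) := by
  obtain ⟨t, rfl⟩ := exists_eq_lineMap_of_lineForm_eq_zero h hz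
  have hne : toR2 p ≠ toR2 q := toR2_injective.ne h
  rw [segment_eq_image_lineMap]
  refine ⟨t, ⟨?_, ?_⟩, rfl⟩
  · by_contra! ht
    refine hne ((mem_extremePoints.1 hp).2 _ hzC _ hq.1 ?_).2.symm
    refine ⟨1 / (1 - t), -t / (1 - t), by apply div_pos <;> linarith,
      by apply div_pos <;> linarith, ?_, ?_⟩
    · rw [← add_div, div_eq_one_iff_eq (by linarith)]
      ring
    · have : 1 - t ≠ 0 := by linarith
      ext <;> simp [AffineMap.lineMap_apply] <;> field_simp <;> ring
  · by_contra! ht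
    refine hne ((mem_extremePoints.1 hq).2 _ hp.1 _ hzC ?_).1
    have : t ≠ 0 := by linarith
    refine ⟨(t - 1) / t, 1 / t, by apply div_pos <;> linarith,
      by apply div_pos <;> linarith, ?_, ?_⟩
    · rw [← add_div, div_eq_one_iff_eq this]
      ring
    · ext <;> simp [AffineMap.lineMap_apply] <;> field_simp <;> ring

theorem lineForm_ne_zero {C : Set (ℝ × ℝ)} {p q r : ℤ × ℤ} (hpq : p ≠ q) (hpr : p ≠ r)
    (hqr : q ≠ r) (hp : toR2 p ∈ C.extremePoints ℝ) (hq : toR2 q ∈ C.extremePoints ℝ)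
    (hr : toR2 r ∈ C.extremePoints ℝ) : lineForm p q (toR2 r) ≠ 0 := by
  intro h
  have hs := mem_segment_of_lineForm_eq_zero hpq hp hq hr.1 h
  rcases (mem_extremePoints_iff_forall_segment.1 hr).2 _ hp.1 _ hq.1 hs with h | h
  · exact hpr (toR2_injective h)
  · exact hqr (toR2_injective h)

/-! ### Parallelograms and triangles -/

/-- The half-open parallelogram with vertex `a` spanned by `b - a` and `c - a`. -/
def halfOpenParallelogram (a b c : ℤ × ℤ) : Set (ℝ × ℝ) :=
  {z | lineForm a c z / lineForm a c (toR2 b) ∈ Set.Ico 0 1 ∧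
    lineForm a b z / lineForm a b (toR2 c) ∈ Set.Ico 0 1}

theorem lineForm_swap (a b c : ℤ × ℤ) :
    lineForm a c (toR2 b) = -lineForm a b (toR2 c) := by
  simp only [lineForm, toR2]
  ring

theorem lineForm_add_zsmul (a b c : ℤ × ℤ) (z : ℝ × ℝ) (i j : ℤ) :
    lineForm a b (z + toR2 (i • (b - a) + j • (c - a)))
      = lineForm a b z + j * lineForm a b (toR2 c) := by
  simp only [lineForm, toR2, Prod.fst_add, Prod.snd_add, Prod.smul_fst, Prod.smul_snd,
    Prod.fst_sub, Prod.snd_sub, smul_eq_mul]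
  push_cast
  ring

theorem latCount_halfOpenParallelogram {a b c : ℤ × ℤ} (h : lineForm a b (toR2 c) ≠ 0)
    (x : ℝ × ℝ) : latCount (halfOpenParallelogram a b c) x =
      Nat.card ((ℤ × ℤ) ⧸ AddSubgroup.closure {b - a, c - a}) := by
  have h' : lineForm a c (toR2 b) ≠ 0 := by
    rw [lineForm_swap]
    exact neg_ne_zero.2 h
  have key : ∀ (m : ℤ × ℤ) (i j : ℤ),
      lineForm a b (toR2 (m + (i • (b - a) + j • (c - a))) - x) / lineForm a b (toR2 c)
        = lineForm a b (toR2 m - x) / lineForm a b (toR2 c) + j ∧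
      lineForm a c (toR2 (m + (i • (b - a) + j • (c - a))) - x) / lineForm a c (toR2 b)
        = lineForm a c (toR2 m - x) / lineForm a c (toR2 b) + i := by
    intro m i j
    have e : toR2 (m + (i • (b - a) + j • (c - a))) - x
        = toR2 m - x + toR2 (i • (b - a) + j • (c - a)) := by
      rw [toR2_add]
      abel
    constructor
    · rw [e, lineForm_add_zsmul]
      field_simp
    · rw [e, add_comm (i • (b - a)), lineForm_add_zsmul]
      field_simp
  unfold latCount
  rw [← Nat.card_coe_set_eq]
  refine Nat.card_congr (Equiv.ofBijective (fun m => QuotientAddGroup.mk m.1) ⟨?_, ?_⟩)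
  · rintro ⟨m, hm1, hm2⟩ ⟨k, hk1, hk2⟩ hmk
    obtain ⟨i, j, hij⟩ := AddSubgroup.mem_closure_pair.1 (QuotientAddGroup.eq.1 hmk)
    obtain rfl : k = m + (i • (b - a) + j • (c - a)) := by rw [hij]; abel
    rw [(key m i j).2] at hk1
    rw [(key m i j).1] at hk2
    have hi : i = 0 := by
      have h1 : (i : ℝ) < 1 := by linarith [hk1.2, hm1.1]
      have h2 : (-1 : ℝ) < i := by linarith [hk1.1, hm1.2]
      have h1' : i < 1 := by exact_mod_cast h1
      have h2' : -1 < i := by exact_mod_cast h2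
      omega
    have hj : j = 0 := by
      have h1 : (j : ℝ) < 1 := by linarith [hk2.2, hm2.1]
      have h2 : (-1 : ℝ) < j := by linarith [hk2.1, hm2.2]
      have h1' : j < 1 := by exact_mod_cast h1
      have h2' : -1 < j := by exact_mod_cast h2
      omega
    simp [hi, hj]
  · intro y
    obtain ⟨m, rfl⟩ := QuotientAddGroup.mk_surjective y
    set i := -⌊lineForm a c (toR2 m - x) / lineForm a c (toR2 b)⌋ with hi
    set j := -⌊lineForm a b (toR2 m - x) / lineForm a b (toR2 c)⌋ with hj
    refine ⟨⟨m + (i • (b - a) + j • (c - a)), ?_, ?_⟩, ?_⟩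
    · rw [(key m i j).2, hi, Int.cast_neg, ← sub_eq_add_neg, Int.self_sub_floor]
      exact ⟨Int.fract_nonneg _, Int.fract_lt_one _⟩
    · rw [(key m i j).1, hj, Int.cast_neg, ← sub_eq_add_neg, Int.self_sub_floor]
      exact ⟨Int.fract_nonneg _, Int.fract_lt_one _⟩
    · refine QuotientAddGroup.eq.2 (AddSubgroup.mem_closure_pair.2 ⟨-i, -j, ?_⟩)
      simp only [neg_smul]
      abel

theorem convexHull_triangle {a b c : ℤ × ℤ} (h : lineForm a b (toR2 c) ≠ 0) :
    convexHull ℝ {toR2 a, toR2 b, toR2 c} =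
      {z | 0 ≤ lineForm a c z / lineForm a c (toR2 b) ∧
        0 ≤ lineForm a b z / lineForm a b (toR2 c) ∧
        lineForm a c z / lineForm a c (toR2 b) + lineForm a b z / lineForm a b (toR2 c) ≤ 1} := by
  have h' : lineForm a c (toR2 b) ≠ 0 := by
    rw [lineForm_swap]
    exact neg_ne_zero.2 h
  have ha : ∀ q, lineForm a q (toR2 a) = 0 := by simp [lineForm, toR2]
  have hb : ∀ q, lineForm a q (toR2 q) = 0 := by
    intro q
    simp only [lineForm, toR2]
    ring
  apply Set.Subset.antisymm
  · refine convexHull_min ?_ ?_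
    · rintro z (rfl | rfl | rfl)
      · simp [ha]
      · simp [hb, div_self h']
      · simp [hb, div_self h]
    · rintro u ⟨hu1, hu2, hu3⟩ w ⟨hw1, hw2, hw3⟩ s t hs ht hst
      simp only [Set.mem_ofPred_eq]
      rw [lineForm_combo a c u w hst, lineForm_combo a b u w hst, add_div, add_div,
        mul_div_assoc, mul_div_assoc, mul_div_assoc, mul_div_assoc]
      refine ⟨by positivity, by positivity, ?_⟩
      nlinarith [mul_le_mul_of_nonneg_left hu3 hs, mul_le_mul_of_nonneg_left hw3 ht]
  · rintro z ⟨h1, h2, h3⟩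
    set s := lineForm a c z / lineForm a c (toR2 b) with hs
    set t := lineForm a b z / lineForm a b (toR2 c) with ht
    have hz : z = (1 - s - t) • toR2 a + s • toR2 b + t • toR2 c := by
      rw [lineForm_swap, div_neg] at hs
      ext
      all_goals
        simp only [Prod.fst_add, Prod.snd_add, Prod.smul_fst, Prod.smul_snd, smul_eq_mul, hs, ht]
        field_simp
        simp only [lineForm, toR2]
        ring
    rw [hz]
    have hc := convex_convexHull ℝ {toR2 a, toR2 b, toR2 c}
    have hmem := subset_convexHull ℝ {toR2 a, toR2 b, toR2 c}
    have := hc.sum_mem (t := Finset.univ) (w := ![1 - s - t, s, t])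
      (z := ![toR2 a, toR2 b, toR2 c])
      (by simp only [Finset.mem_univ, forall_const, Fin.forall_fin_succ]; simp; grind)
      (by simp [Fin.sum_univ_three]; ring)
      (by
        simp only [Finset.mem_univ, forall_const, Fin.forall_fin_succ]
        simpa using ⟨hmem (by simp), hmem (by simp), hmem (by simp)⟩)
    simpa [Fin.sum_univ_three] using this

/-! ### Sets whose count plus its reflection is almost everywhere constant -/

/-- The lattice counts of `A` at `x` and at `-x` have almost everywhere constant sum. -/
def HasConstantReflectionSum (A : Set (ℝ × ℝ)) : Prop :=
  ∃ c : ℕ, ∀ᵐ x : ℝ × ℝ, latCount A x + latCount A (-x) = c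

theorem ae_comp_neg {p : ℝ × ℝ → Prop} (h : ∀ᵐ x, p x) : ∀ᵐ x, p (-x) := by
  simpa using (measurePreserving_sub_left_R2 0).quasiMeasurePreserving.ae h

theorem HasConstantReflectionSum.of_volume_eq_zero {A : Set (ℝ × ℝ)} (hA : volume A = 0) :
    HasConstantReflectionSum A := by
  have h : ∀ᵐ x : ℝ × ℝ, latCount A x = 0 := by
    filter_upwards [ae_forall_toR2_sub_notMem hA] with x hx
    simp [latCount, hx]
  refine ⟨0, ?_⟩
  filter_upwards [h, ae_comp_neg h] with x h1 h2
  rw [h1, h2]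

theorem HasConstantReflectionSum.union {A B N : Set (ℝ × ℝ)} (hA : Bornology.IsBounded A)
    (hB : Bornology.IsBounded B) (hN : volume N = 0) (hAB : A ∩ B ⊆ N)
    (hcA : HasConstantReflectionSum A) (hcB : HasConstantReflectionSum B) :
    HasConstantReflectionSum (A ∪ B) := by
  obtain ⟨c, hc⟩ := hcA
  obtain ⟨d, hd⟩ := hcB
  refine ⟨c + d, ?_⟩
  have h := ae_latCount_union hA hB hN hAB
  filter_upwards [h, ae_comp_neg h, hc, hd] with x h1 h2 h3 h4
  omega

theorem HasConstantReflectionSum.of_subset_line {A : Set (ℝ × ℝ)} {p q : ℤ × ℤ} (h : p ≠ q)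
    (hA : A ⊆ {z | lineForm p q z = 0}) : HasConstantReflectionSum A :=
  .of_volume_eq_zero (measure_mono_null hA (volume_lineForm_eq h 0))

theorem convexHull_subset_line {p q : ℤ × ℤ} {T : Set (ℝ × ℝ)}
    (hT : ∀ z ∈ T, lineForm p q z = 0) : convexHull ℝ T ⊆ {z | lineForm p q z = 0} := by
  intro z hz
  exact le_antisymm
    (convexHull_min (fun w hw => (hT w hw).le) (convex_lineForm_nonpos p q) hz)
    (convexHull_min (fun w hw => (hT w hw).ge) (convex_lineForm_nonneg p q) hz)

theorem hasConstantReflectionSum_triangle_of_ne_zero {a b c : ℤ × ℤ}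
    (h : lineForm a b (toR2 c) ≠ 0) :
    HasConstantReflectionSum (convexHull ℝ {toR2 a, toR2 b, toR2 c}) := by
  have h' : lineForm a c (toR2 b) ≠ 0 := by
    rw [lineForm_swap]
    exact neg_ne_zero.2 h
  have hab : a ≠ b := by
    rintro rfl
    simp [lineForm] at h
  have hac : a ≠ c := by
    rintro rfl
    simp [lineForm] at h'
  have hbc : b ≠ c := by
    rintro rfl
    apply h
    simp only [lineForm, toR2]
    ring
  set T := convexHull ℝ {toR2 a, toR2 b, toR2 c} with hT
  set T' := {z | toR2 (b + c) - z ∈ T} with hT'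
  have hTc : IsCompact T := (Set.toFinite {toR2 a, toR2 b, toR2 c}).isCompact_convexHull (𝕜 := ℝ)
  have hT'c : IsCompact T' := by
    convert hTc.image (f := fun z => toR2 (b + c) - z) (by fun_prop) using 1
    ext z
    refine ⟨fun hz => ⟨_, hz, by simp⟩, ?_⟩
    rintro ⟨w, hw, rfl⟩
    simpa [hT'] using hw
  set N := {z | lineForm b c z = 0} with hN
  set N' := N ∪ {z | lineForm a c z = lineForm a c (toR2 b)}
    ∪ {z | lineForm a b z = lineForm a b (toR2 c)} with hN'
  have hN0 : volume N = 0 := volume_lineForm_eq hbc 0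
  have hN'0 : volume N' = 0 := by
    simp only [hN', measure_union_null_iff]
    exact ⟨⟨hN0, volume_lineForm_eq hac _⟩, volume_lineForm_eq hab _⟩
  have hmemN : ∀ z, z ∈ N ↔
      lineForm a c z / lineForm a c (toR2 b) + lineForm a b z / lineForm a b (toR2 c) = 1 := by
    intro z
    have e : lineForm b c z = lineForm a b (toR2 c) - lineForm a b z + lineForm a c z := by
      simp only [lineForm, toR2]
      ring
    rw [hN, Set.mem_ofPred_eq, e, lineForm_swap a b c, div_neg, ← sub_eq_neg_add, ← sub_div,
      div_eq_one_iff_eq h]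
    constructor <;> intro h <;> linarith
  have hmemT' : ∀ z, z ∈ T' ↔ lineForm a c z / lineForm a c (toR2 b) ≤ 1 ∧
      lineForm a b z / lineForm a b (toR2 c) ≤ 1 ∧
      1 ≤ lineForm a c z / lineForm a c (toR2 b) + lineForm a b z / lineForm a b (toR2 c) := by
    intro z
    have e1 : lineForm a c (toR2 (b + c) - z) = lineForm a c (toR2 b) - lineForm a c z := by
      simp only [lineForm, toR2, Prod.fst_sub, Prod.snd_sub, Prod.fst_add, Prod.snd_add]
      push_cast
      ring
    have e2 : lineForm a b (toR2 (b + c) - z) = lineForm a b (toR2 c) - lineForm a b z := by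
      simp only [lineForm, toR2, Prod.fst_sub, Prod.snd_sub, Prod.fst_add, Prod.snd_add]
      push_cast
      ring
    rw [hT', Set.mem_ofPred_eq, hT, convexHull_triangle h, Set.mem_ofPred_eq, e1, e2, sub_div,
      sub_div, div_self h, div_self h']
    constructor <;> rintro ⟨h1, h2, h3⟩ <;> refine ⟨?_, ?_, ?_⟩ <;> linarith
  have hTT' : T ∩ T' ⊆ N := by
    rintro z ⟨hz, hz'⟩
    rw [hT, convexHull_triangle h] at hz
    exact (hmemN z).2 (le_antisymm hz.2.2 ((hmemT' z).1 hz').2.2)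
  have hpar : ∀ z, z ∉ N' → (z ∈ T ∪ T' ↔ z ∈ halfOpenParallelogram a b c) := by
    intro z hz
    simp only [hN', Set.mem_union, Set.mem_ofPred_eq, not_or] at hz
    rw [Set.mem_union, hmemT', hT, convexHull_triangle h]
    obtain ⟨⟨-, h3⟩, h5⟩ := hz
    have h3' := mt (div_eq_one_iff_eq h').1 h3
    have h5' := mt (div_eq_one_iff_eq h).1 h5
    simp only [halfOpenParallelogram, Set.mem_ofPred_eq, Set.mem_Ico]
    generalize lineForm a c z / lineForm a c (toR2 b) = s at *
    generalize lineForm a b z / lineForm a b (toR2 c) = t at *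
    constructor
    · rintro (⟨hs, ht, hst⟩ | ⟨hs, ht, hst⟩)
      · exact ⟨⟨hs, lt_of_le_of_ne (by linarith) h3'⟩, ht, lt_of_le_of_ne (by linarith) h5'⟩
      · exact ⟨⟨by linarith, lt_of_le_of_ne hs h3'⟩, by linarith, lt_of_le_of_ne ht h5'⟩
    · rintro ⟨⟨hs, hs'⟩, ht, ht'⟩
      rcases le_total (s + t) 1 with hst | hst
      · exact Or.inl ⟨hs, ht, hst⟩
      · exact Or.inr ⟨hs'.le, ht'.le, hst⟩
  refine ⟨Nat.card ((ℤ × ℤ) ⧸ AddSubgroup.closure {b - a, c - a}), ?_⟩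
  filter_upwards [ae_latCount_union hTc.isBounded hT'c.isBounded hN0 hTT',
    ae_forall_toR2_sub_notMem hN'0] with x hx hx'
  rw [latCount_neg T (b + c), ← hx, ← latCount_halfOpenParallelogram h x]
  unfold latCount
  congr 1
  ext m
  exact hpar _ (hx' m)

theorem hasConstantReflectionSum_triangle (a b c : ℤ × ℤ) :
    HasConstantReflectionSum (convexHull ℝ {toR2 a, toR2 b, toR2 c}) := by
  by_cases h : lineForm a b (toR2 c) = 0
  · have hself : ∀ p q, lineForm p q (toR2 p) = 0 := by simp [lineForm, toR2]
    have hself' : ∀ p q, lineForm p q (toR2 q) = 0 := by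
      intro p q
      simp only [lineForm, toR2]
      ring
    obtain ⟨p, q, hpq, h1, h2, h3⟩ : ∃ p q, p ≠ q ∧ lineForm p q (toR2 a) = 0 ∧
        lineForm p q (toR2 b) = 0 ∧ lineForm p q (toR2 c) = 0 := by
      by_cases hab : a = b
      · subst hab
        by_cases hac : a = c
        · subst hac
          exact ⟨a, a + (1, 0), by simp [Prod.ext_iff], hself _ _, hself _ _, hself _ _⟩
        · exact ⟨a, c, hac, hself _ _, hself _ _, hself' _ _⟩
      · exact ⟨a, b, hab, hself _ _, hself' _ _, h⟩
    refine .of_subset_line hpq (convexHull_subset_line ?_)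
    rintro z (rfl | rfl | rfl) <;> assumption
  · exact hasConstantReflectionSum_triangle_of_ne_zero h

/-! ### Cutting a lattice polygon along a diagonal -/

theorem exists_mem_segment_lineForm_eq_zero {p q : ℤ × ℤ} {u w : ℝ × ℝ}
    (hu : 0 ≤ lineForm p q u) (hw : lineForm p q w ≤ 0) :
    ∃ s ∈ Set.Icc (0 : ℝ) 1, lineForm p q (AffineMap.lineMap u w s) = 0 := by
  have hc : ContinuousOn (fun s : ℝ => lineForm p q (AffineMap.lineMap u w s)) (Set.Icc 0 1) := by
    have hl : Continuous (lineForm p q) := by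
      unfold lineForm
      fun_prop
    exact (hl.comp AffineMap.lineMap_continuous).continuousOn
  have := intermediate_value_Icc' zero_le_one hc
  simp only [AffineMap.lineMap_apply_zero, AffineMap.lineMap_apply_one] at this
  exact this ⟨hw, hu⟩

theorem Convex.lineMap_mem_of_mem_Icc {C : Set (ℝ × ℝ)} (hC : Convex ℝ C) {u w : ℝ × ℝ}
    {r s t : ℝ} (hr : AffineMap.lineMap u w r ∈ C) (ht : AffineMap.lineMap u w t ∈ C)
    (hs : s ∈ Set.Icc r t) : AffineMap.lineMap u w s ∈ C :=
  (hC.affine_preimage (AffineMap.lineMap u w)).ordConnected.out hr ht hs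

theorem convexHull_eq_union_of_extremePoints {T : Set (ℝ × ℝ)} {p q : ℤ × ℤ} (h : p ≠ q)
    (hp : toR2 p ∈ (convexHull ℝ T).extremePoints ℝ)
    (hq : toR2 q ∈ (convexHull ℝ T).extremePoints ℝ) :
    convexHull ℝ T = convexHull ℝ {z ∈ T | 0 ≤ lineForm p q z} ∪
      convexHull ℝ {z ∈ T | lineForm p q z ≤ 0} := by
  have hself : lineForm p q (toR2 p) = 0 := by simp [lineForm, toR2]
  have hself' : lineForm p q (toR2 q) = 0 := by
    simp only [lineForm, toR2]
    ring
  have hpT := extremePoints_convexHull_subset hp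
  have hqT := extremePoints_convexHull_subset hq
  set T₁ := {z ∈ T | 0 ≤ lineForm p q z} with hT₁
  set T₂ := {z ∈ T | lineForm p q z ≤ 0} with hT₂
  have hp₁ : toR2 p ∈ T₁ := ⟨hpT, hself.ge⟩
  have hp₂ : toR2 p ∈ T₂ := ⟨hpT, hself.le⟩
  have hq₁ : toR2 q ∈ T₁ := ⟨hqT, hself'.ge⟩
  have hq₂ : toR2 q ∈ T₂ := ⟨hqT, hself'.le⟩
  have hsub₁ : convexHull ℝ T₁ ⊆ convexHull ℝ T := convexHull_mono (Set.sep_subset _ _)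
  have hsub₂ : convexHull ℝ T₂ ⊆ convexHull ℝ T := convexHull_mono (Set.sep_subset _ _)
  refine Set.Subset.antisymm ?_ (Set.union_subset hsub₁ hsub₂)
  have hT : T = T₁ ∪ T₂ := by
    ext z
    have := le_total 0 (lineForm p q z)
    simp only [hT₁, hT₂, Set.mem_union, Set.mem_ofPred_eq]
    tauto
  intro z hz
  rw [hT, convexHull_union ⟨_, hp₁⟩ ⟨_, hp₂⟩, mem_convexJoin] at hz
  obtain ⟨u, hu, w, hw, hz⟩ := hz
  rw [segment_eq_image_lineMap] at hz
  obtain ⟨t, ⟨ht0, ht1⟩, rfl⟩ := hz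
  have hu' : 0 ≤ lineForm p q u :=
    convexHull_min (fun v hv => hv.2) (convex_lineForm_nonneg p q) hu
  have hw' : lineForm p q w ≤ 0 :=
    convexHull_min (fun v hv => hv.2) (convex_lineForm_nonpos p q) hw
  obtain ⟨s, hs, hs'⟩ := exists_mem_segment_lineForm_eq_zero hu' hw'
  have hmem : AffineMap.lineMap u w s ∈ convexHull ℝ T :=
    (convex_convexHull ℝ T).lineMap_mem (hsub₁ hu) (hsub₂ hw) hs
  have hseg := mem_segment_of_lineForm_eq_zero h hp hq hmem hs'
  rcases le_total t s with hts | hst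
  · exact Or.inl ((convex_convexHull ℝ T₁).lineMap_mem_of_mem_Icc (by simpa using hu)
      (segment_subset_convexHull hp₁ hq₁ hseg) ⟨ht0, hts⟩)
  · exact Or.inr ((convex_convexHull ℝ T₂).lineMap_mem_of_mem_Icc
      (segment_subset_convexHull hp₂ hq₂ hseg) (by simpa using hw) ⟨hst, ht1⟩)

/-- Among four points in convex position, some diagonal separates the two remaining points. -/
theorem exists_separating_diagonal {C : Set (ℝ × ℝ)} {S : Finset (ℤ × ℤ)}
    (hS : ∀ m ∈ S, toR2 m ∈ C.extremePoints ℝ) (hcard : 3 < S.card) :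
    ∃ p ∈ S, ∃ q ∈ S, ∃ e ∈ S, ∃ f ∈ S, p ≠ q ∧ lineForm p q (toR2 e) < 0 ∧
      0 < lineForm p q (toR2 f) := by
  obtain ⟨a, ha⟩ : S.Nonempty := Finset.card_pos.1 (by omega)
  obtain ⟨b, hb, c, hc, d, hd, hbc, hbd, hcd⟩ := Finset.two_lt_card.1
    (by rw [Finset.card_erase_of_mem ha]; omega : 2 < (S.erase a).card)
  rw [Finset.mem_erase] at hb hc hd
  have hβ := lineForm_ne_zero hb.1.symm hc.1.symm hbc (hS a ha) (hS b hb.2) (hS c hc.2)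
  have hγ := lineForm_ne_zero hc.1.symm hd.1.symm hcd (hS a ha) (hS c hc.2) (hS d hd.2)
  have hδ := lineForm_ne_zero hd.1.symm hb.1.symm hbd.symm (hS a ha) (hS d hd.2) (hS b hb.2)
  have hβ' := lineForm_swap a b c
  have hγ' := lineForm_swap a c d
  have hδ' := lineForm_swap a d b
  rcases hβ.lt_or_gt with hβ | hβ <;> rcases hγ.lt_or_gt with hγ | hγ <;>
    rcases hδ.lt_or_gt with hδ | hδ
  · exact ⟨a, ha, b, hb.2, c, hc.2, d, hd.2, hb.1.symm, by linarith, by linarith⟩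
  · exact ⟨a, ha, c, hc.2, d, hd.2, b, hb.2, hc.1.symm, by linarith, by linarith⟩
  · exact ⟨a, ha, b, hb.2, c, hc.2, d, hd.2, hb.1.symm, by linarith, by linarith⟩
  · exact ⟨a, ha, d, hd.2, c, hc.2, b, hb.2, hd.1.symm, by linarith, by linarith⟩
  · exact ⟨a, ha, d, hd.2, b, hb.2, c, hc.2, hd.1.symm, by linarith, by linarith⟩
  · exact ⟨a, ha, b, hb.2, d, hd.2, c, hc.2, hb.1.symm, by linarith, by linarith⟩
  · exact ⟨a, ha, c, hc.2, b, hb.2, d, hd.2, hc.1.symm, by linarith, by linarith⟩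
  · exact ⟨a, ha, b, hb.2, d, hd.2, c, hc.2, hb.1.symm, by linarith, by linarith⟩

theorem hasConstantReflectionSum_of_card_le_three {S : Finset (ℤ × ℤ)} (hS : S.card ≤ 3) :
    HasConstantReflectionSum (convexHull ℝ (toR2 '' S)) := by
  classical
  rcases S.eq_empty_or_nonempty with rfl | hne
  · exact .of_volume_eq_zero (by simp)
  obtain ⟨a, b, c, rfl⟩ : ∃ a b c, S = {a, b, c} := by
    have := hne.card_pos
    interval_cases h : S.card
    · obtain ⟨a, rfl⟩ := Finset.card_eq_one.1 h
      exact ⟨a, a, a, by simp⟩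
    · obtain ⟨a, b, -, rfl⟩ := Finset.card_eq_two.1 h
      exact ⟨a, a, b, by simp⟩
    · obtain ⟨a, b, c, -, -, -, rfl⟩ := Finset.card_eq_three.1 h
      exact ⟨a, b, c, rfl⟩
  convert hasConstantReflectionSum_triangle a b c using 2
  simp [Set.image_insert_eq]

theorem exists_subset_extremePoints (S : Finset (ℤ × ℤ)) :
    ∃ S' ⊆ S, convexHull ℝ (toR2 '' S') = convexHull ℝ (toR2 '' S) ∧
      ∀ m ∈ S', toR2 m ∈ (convexHull ℝ (toR2 '' S')).extremePoints ℝ := by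
  classical
  set C := convexHull ℝ (toR2 '' S) with hC
  have hfin : (toR2 '' (S : Set (ℤ × ℤ))).Finite := S.finite_toSet.image _
  have himage : toR2 '' ↑(S.filter fun m => toR2 m ∈ C.extremePoints ℝ) = C.extremePoints ℝ := by
    ext z
    simp only [Finset.coe_filter, Set.mem_image, Set.mem_ofPred_eq]
    constructor
    · rintro ⟨m, hm, rfl⟩
      exact hm.2
    · intro hz
      obtain ⟨m, hm, rfl⟩ := extremePoints_convexHull_subset hz
      exact ⟨m, ⟨hm, hz⟩, rfl⟩
  have hext : convexHull ℝ (C.extremePoints ℝ) = C := by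
    have hkm := closure_convexHull_extremePoints (hfin.isCompact_convexHull (𝕜 := ℝ))
      (convex_convexHull ℝ _)
    rwa [((hfin.subset extremePoints_convexHull_subset).isClosed_convexHull
      (𝕜 := ℝ)).closure_eq] at hkm
  refine ⟨S.filter fun m => toR2 m ∈ C.extremePoints ℝ, Finset.filter_subset _ _, ?_, ?_⟩
  · rw [himage, hext]
  · intro m hm
    rw [himage, hext]
    exact (Finset.mem_filter.1 hm).2

theorem hasConstantReflectionSum_convexHull (S : Finset (ℤ × ℤ)) :
    HasConstantReflectionSum (convexHull ℝ (toR2 '' S)) := by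
  induction S using Finset.strongInduction with
  | H S ih =>
    obtain ⟨S', hS', heq, hext⟩ := exists_subset_extremePoints S
    rw [← heq]
    rcases le_or_gt S'.card 3 with hcard | hcard
    · exact hasConstantReflectionSum_of_card_le_three hcard
    obtain ⟨p, hp, q, hq, e, he, f, hf, hpq, hen, hfp⟩ := exists_separating_diagonal hext hcard
    have h₁ : {z ∈ toR2 '' S' | 0 ≤ lineForm p q z}
        = toR2 '' ↑(S'.filter fun m => 0 ≤ lineForm p q (toR2 m)) := by
      ext z
      simp only [Finset.coe_filter, Set.mem_image, Set.mem_ofPred_eq]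
      grind
    have h₂ : {z ∈ toR2 '' S' | lineForm p q z ≤ 0}
        = toR2 '' ↑(S'.filter fun m => lineForm p q (toR2 m) ≤ 0) := by
      ext z
      simp only [Finset.coe_filter, Set.mem_image, Set.mem_ofPred_eq]
      grind
    have hs₁ : S'.filter (fun m => 0 ≤ lineForm p q (toR2 m)) ⊂ S :=
      (Finset.filter_ssubset.2 ⟨e, he, hen.not_ge⟩).trans_subset hS'
    have hs₂ : S'.filter (fun m => lineForm p q (toR2 m) ≤ 0) ⊂ S :=
      (Finset.filter_ssubset.2 ⟨f, hf, hfp.not_ge⟩).trans_subset hS'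
    rw [convexHull_eq_union_of_extremePoints hpq (hext p hp) (hext q hq)]
    have hfin : (toR2 '' (S' : Set (ℤ × ℤ))).Finite := S'.finite_toSet.image _
    refine .union ((hfin.subset (Set.sep_subset _ _)).isCompact_convexHull (𝕜 := ℝ)).isBounded
      ((hfin.subset (Set.sep_subset _ _)).isCompact_convexHull (𝕜 := ℝ)).isBounded
      (volume_lineForm_eq hpq 0) ?_ ?_ ?_
    · rintro z ⟨hz₁, hz₂⟩
      exact le_antisymm
        (convexHull_min (fun v hv => hv.2) (convex_lineForm_nonpos p q) hz₂)
        (convexHull_min (fun v hv => hv.2) (convex_lineForm_nonneg p q) hz₁)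
    · rw [h₁]
      exact ih _ hs₁
    · rw [h₂]
      exact ih _ hs₂

/-! ### Symmetry of the centered distribution -/

theorem measurePreserving_reflect_unit :
    MeasurePreserving (fun x : ℝ × ℝ => toR2 (1, 1) - x) μunit μunit := by
  have h := (measurePreserving_sub_left_R2 (toR2 (1, 1))).restrict_preimage
    (measurableSet_Icc (a := (0 : ℝ × ℝ)) (b := 1))
  have e : (fun x : ℝ × ℝ => toR2 (1, 1) - x) ⁻¹' Set.Icc 0 1 = Set.Icc 0 1 := by
    ext x
    simp only [Set.mem_preimage, Set.mem_Icc, Prod.le_def, toR2, Prod.fst_sub, Prod.snd_sub,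
      Prod.fst_zero, Prod.snd_zero, Prod.fst_one, Prod.snd_one, Int.cast_one]
    grind
  rwa [e] at h

instance : IsProbabilityMeasure μunit := by
  constructor
  rw [μunit, Measure.restrict_apply_univ, Measure.volume_eq_prod, ← Prod.mk_zero_zero,
    ← Prod.mk_one_one, ← Set.Icc_prod_Icc, Measure.prod_prod]
  simp

theorem HasConstantReflectionSum.map_centered_eq {A : Set (ℝ × ℝ)}
    (hA : HasConstantReflectionSum A) :
    Measure.map (fun x => (latCount A x : ℝ) - ∫ y, (latCount A y : ℝ) ∂μunit) μunit
      = Measure.map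
          (fun x => -((latCount A x : ℝ) - ∫ y, (latCount A y : ℝ) ∂μunit)) μunit := by
  set g : ℝ × ℝ → ℝ := fun x => latCount A x with hg
  set E := ∫ y, g y ∂μunit with hE
  obtain ⟨c, hc⟩ := hA
  set R : ℝ × ℝ → ℝ × ℝ := fun x => toR2 (1, 1) - x with hR
  have hRμ : MeasurePreserving R μunit μunit := measurePreserving_reflect_unit
  have hsum : ∀ᵐ x ∂μunit, g x + g (R x) = c := by
    filter_upwards [ae_restrict_of_ae hc] with x hx
    simp only [hg, hR, latCount_sub_toR2]
    exact_mod_cast hx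
  by_cases hm : AEMeasurable g μunit
  · have hint : Integrable g μunit := by
      refine Integrable.of_bound hm.aestronglyMeasurable c ?_
      filter_upwards [hsum] with x hx
      have h1 : 0 ≤ g (R x) := Nat.cast_nonneg _
      rw [Real.norm_of_nonneg (Nat.cast_nonneg _)]
      linarith
    have hER : ∫ x, g (R x) ∂μunit = E := by
      conv_rhs => rw [hE, ← hRμ.map_eq]
      exact (integral_map hRμ.aemeasurable (by rw [hRμ.map_eq]; exact hint.1)).symm
    have h2E : E + E = c := by
      calc E + E = ∫ x, g x + g (R x) ∂μunit := by
            rw [integral_add hint (g := fun x => g (R x))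
              (hRμ.integrable_comp_of_integrable hint), hER]
        _ = ∫ _, (c : ℝ) ∂μunit := integral_congr_ae hsum
        _ = c := by simp
    have hm' : AEMeasurable (fun x => g x - E) (Measure.map R μunit) := by
      rw [hRμ.map_eq]
      exact hm.sub_const E
    calc Measure.map (fun x => g x - E) μunit
        = Measure.map (fun x => g x - E) (Measure.map R μunit) := by rw [hRμ.map_eq]
      _ = Measure.map ((fun x => g x - E) ∘ R) μunit :=
          AEMeasurable.map_map_of_aemeasurable hm' hRμ.aemeasurable
      _ = Measure.map (fun x => -(g x - E)) μunit := by
          refine Measure.map_congr ?_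
          filter_upwards [hsum] with x hx
          simp only [Function.comp_apply]
          linarith
  · rw [Measure.map_of_not_aemeasurable, Measure.map_of_not_aemeasurable]
    · intro h
      refine hm ((h.neg.add_const E).congr (Eventually.of_forall fun x => ?_))
      simp [hg]
    · intro h
      refine hm ((h.add_const E).congr (Eventually.of_forall fun x => ?_))
      simp [hg]

/-- For an integer polygon `P`, the centered random variable
`X_P - E[X_P]` has a symmetric distribution: it is distributed as its negative. -/
theorem latCount_centered_symmetric (n : ℕ) (a : Fin (n + 3) → ℤ × ℤ)
    (hccw : ∀ i : Fin (n + 3), 0 < zcross (a (i + 1) - a i) (a (i + 2) - a (i + 1)))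
    (P : Set (ℝ × ℝ)) (hP : P = convexHull ℝ (Set.range fun i => toR2 (a i))) :
    Measure.map (fun x => (latCount P x : ℝ) - ∫ y, (latCount P y : ℝ) ∂μunit) μunit
      = Measure.map
          (fun x => -((latCount P x : ℝ) - ∫ y, (latCount P y : ℝ) ∂μunit)) μunit := by
  subst hP
  have h := hasConstantReflectionSum_convexHull (Finset.univ.image a)
  rw [Finset.coe_image, Finset.coe_univ, Set.image_univ, ← Set.range_comp] at h
  exact h.map_centered_eq
end
end

section
/- Let A, B ⊆ ℝ^d be compact sets. Then cov(X_A, X_B) = Σ_{n ∈ ℤ^d} g_{A,B}(n) − ∫_{ℝ^d} g_{A,B}(x) dx = Σ_{n ∈ ℤ^d} g_{A,B}(n) − vol(A)·vol(B), where X_A and X_B are evaluated at the same uniform random point X ∈ [0,1]^d; in particular Var(X_A) = Σ_{n ∈ ℤ^d} g_A(n) − ∫_{ℝ^d} g_A(x) dx. -/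
open MeasureTheory

noncomputable section

/-- `latCountD C x = |(C + x) ∩ ℤ^d|`. -/
def latCountD (d : ℕ) (C : Set (Fin d → ℝ)) (x : Fin d → ℝ) : ℕ :=
  Set.ncard {m : Fin d → ℤ | ((fun i => (m i : ℝ)) - x) ∈ C}

/-- The uniform distribution on the unit cube `[0,1]^d`. -/
def μcube (d : ℕ) : Measure (Fin d → ℝ) := volume.restrict (Set.Icc 0 1)

/-- The cross covariogram `g_{A,B}(x) = vol(A ∩ (B + x))`. -/
def crossCovariogram (d : ℕ) (A B : Set (Fin d → ℝ)) (x : Fin d → ℝ) : ℝ :=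
  (volume (A ∩ ((· + x) '' B))).toReal

/-- Unfolding over the integer translates of the unit cube. -/
theorem lintegral_μcube_tsum_sub (d : ℕ) {f : (Fin d → ℝ) → ENNReal} (hf : Measurable f) :
    ∫⁻ x, ∑' m : Fin d → ℤ, f ((fun i => (m i : ℝ)) - x) ∂μcube d = ∫⁻ x, f x := by
  have hcube : μcube d = volume.restrict (Set.univ.pi fun _ : Fin d => Set.Ico (0 : ℝ) 1) :=
    (Measure.restrict_congr_set (Measure.univ_pi_Ico_ae_eq_Icc (μ := fun _ : Fin d => volume)
      (f := 0) (g := 1))).symm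
  have hmeas : MeasurableSet (Set.univ.pi fun _ : Fin d => Set.Ico (0 : ℝ) 1) :=
    MeasurableSet.univ_pi fun _ => measurableSet_Ico
  have hmem : ∀ (m : Fin d → ℤ) (y : Fin d → ℝ),
      ((fun i => (m i : ℝ)) - y) ∈ (Set.univ.pi fun _ : Fin d => Set.Ico (0 : ℝ) 1) ↔
        (fun i => ⌈y i⌉) = m := by
    intro m y
    simp only [Set.mem_pi, Set.mem_univ, forall_const, Set.mem_Ico, Pi.sub_apply, funext_iff,
      Int.ceil_eq_iff]
    refine forall_congr' fun i => ?_
    constructor <;> rintro ⟨h1, h2⟩ <;> constructor <;> linarith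
  have hfm : ∀ m : Fin d → ℤ, Measurable fun x => f ((fun i => (m i : ℝ)) - x) := fun m =>
    hf.comp (measurable_const.sub measurable_id)
  rw [hcube, lintegral_tsum fun m => (hfm m).aemeasurable]
  have key : ∀ m : Fin d → ℤ,
      ∫⁻ x in Set.univ.pi fun _ : Fin d => Set.Ico (0 : ℝ) 1, f ((fun i => (m i : ℝ)) - x) =
        ∫⁻ y in {y : Fin d → ℝ | (fun i => ⌈y i⌉) = m}, f y := by
    intro m
    have h := (Measure.measurePreserving_sub_left (volume : Measure (Fin d → ℝ))
      (fun i => (m i : ℝ))).setLIntegral_comp_preimage hmeas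
      (hfm m)
    rw [← h]
    simp only [sub_sub_cancel]
    congr 2
    ext y
    exact hmem m y
  simp_rw [key]
  rw [← lintegral_iUnion]
  · congr 1
    rw [Set.iUnion_eq_univ_iff.2 fun y => ⟨fun i => ⌈y i⌉, rfl⟩, Measure.restrict_univ]
  · intro m
    have : Measurable fun y : Fin d → ℝ => fun i => ⌈y i⌉ :=
      measurable_pi_lambda _ fun i => Int.measurable_ceil.comp (measurable_pi_apply i)
    exact this (measurableSet_singleton m)
  · intro m n hmn
    exact Set.disjoint_left.2 fun y hy hy' => hmn (hy.symm.trans hy')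

theorem finite_setOf_norm_intCast_le (d : ℕ) (R : ℝ) :
    {m : Fin d → ℤ | ‖(fun i => (m i : ℝ))‖ ≤ R}.Finite := by
  refine (Set.finite_Icc (fun _ => -⌈R⌉) (fun _ => ⌈R⌉)).subset fun m hm => ?_
  have h : ∀ i, |m i| ≤ ⌈R⌉ := fun i => by
    have h1 : |(m i : ℝ)| ≤ R := (norm_le_pi_norm (fun i => (m i : ℝ)) i).trans hm
    exact_mod_cast h1.trans (Int.le_ceil R)
  exact ⟨fun i => (abs_le.1 (h i)).1, fun i => (abs_le.1 (h i)).2⟩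

theorem exists_norm_intCast_le_of_isCompact {d : ℕ} {C : Set (Fin d → ℝ)} (hC : IsCompact C) :
    ∃ R : ℝ, ∀ (x : Fin d → ℝ), {m : Fin d → ℤ | ((fun i => (m i : ℝ)) - x) ∈ C} ⊆
      {m : Fin d → ℤ | ‖(fun i => (m i : ℝ))‖ ≤ R + ‖x‖} := by
  obtain ⟨R, hR⟩ := hC.isBounded.exists_norm_le
  refine ⟨R, fun x m hm => ?_⟩
  have h := norm_add_le ((fun i => (m i : ℝ)) - x) x
  rw [sub_add_cancel] at h
  exact h.trans (add_le_add_left (hR _ hm) _)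

theorem latCountD_eq_tsum {d : ℕ} {C : Set (Fin d → ℝ)} (hC : IsCompact C) (x : Fin d → ℝ) :
    (latCountD d C x : ENNReal) =
      ∑' m : Fin d → ℤ, C.indicator 1 ((fun i => (m i : ℝ)) - x) := by
  obtain ⟨R, hR⟩ := exists_norm_intCast_le_of_isCompact hC
  have hfin := (finite_setOf_norm_intCast_le d _).subset (hR x)
  have h := ENNReal.tsum_set_one {m : Fin d → ℤ | ((fun i => (m i : ℝ)) - x) ∈ C}
  rw [← hfin.cast_ncard_eq] at h
  rw [tsum_subtype _ (fun _ => (1 : ENNReal))] at h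
  exact h.symm

theorem exists_latCountD_le {d : ℕ} {C : Set (Fin d → ℝ)} (hC : IsCompact C) :
    ∃ K : ℕ, ∀ x ∈ Set.Icc (0 : Fin d → ℝ) 1, latCountD d C x ≤ K := by
  obtain ⟨R, hR⟩ := exists_norm_intCast_le_of_isCompact hC
  refine ⟨_, fun x hx => Set.ncard_le_ncard ((hR x).trans fun m hm => ?_)
    (finite_setOf_norm_intCast_le d (R + 1))⟩
  have h1 : ‖x‖ ≤ 1 := (pi_norm_le_iff_of_nonneg zero_le_one).2 fun i => by
    rw [Real.norm_of_nonneg (hx.1 i)]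
    exact hx.2 i
  exact le_trans hm (add_le_add_right h1 R)

theorem measurable_intCast_sub_indicator {d : ℕ} {C : Set (Fin d → ℝ)} (hC : MeasurableSet C)
    (m : Fin d → ℤ) :
    Measurable fun x => C.indicator (1 : (Fin d → ℝ) → ENNReal) ((fun i => (m i : ℝ)) - x) :=
  (measurable_one.indicator hC).comp (measurable_const.sub measurable_id)

theorem measurable_latCountD {d : ℕ} {C : Set (Fin d → ℝ)} (hC : IsCompact C) :
    Measurable fun x => (latCountD d C x : ℝ) := by
  have h : Measurable fun x => (latCountD d C x : ENNReal) := by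
    simp_rw [latCountD_eq_tsum hC]
    exact Measurable.tsum fun m => measurable_intCast_sub_indicator hC.measurableSet m
  simpa using h.ennreal_toReal

instance isProbabilityMeasure_μcube (d : ℕ) : IsProbabilityMeasure (μcube d) :=
  ⟨by simp [μcube, Real.volume_Icc_pi]⟩

theorem memLp_latCountD {d : ℕ} {C : Set (Fin d → ℝ)} (hC : IsCompact C) (p : ENNReal) :
    MemLp (fun x => (latCountD d C x : ℝ)) p (μcube d) := by
  obtain ⟨K, hK⟩ := exists_latCountD_le hC
  refine MemLp.of_bound (measurable_latCountD hC).aestronglyMeasurable K ?_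
  filter_upwards [ae_restrict_mem measurableSet_Icc] with x hx
  simpa using hK x hx

theorem integral_latCountD {d : ℕ} {C : Set (Fin d → ℝ)} (hC : IsCompact C) :
    ∫ x, (latCountD d C x : ℝ) ∂μcube d = (volume C).toReal := by
  rw [integral_eq_lintegral_of_nonneg_ae (Filter.Eventually.of_forall fun _ => Nat.cast_nonneg _)
    (measurable_latCountD hC).aestronglyMeasurable]
  simp_rw [ENNReal.ofReal_natCast, latCountD_eq_tsum hC]
  rw [lintegral_μcube_tsum_sub d (measurable_one.indicator hC.measurableSet),
    lintegral_indicator_one hC.measurableSet]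

theorem inter_image_add_indicator {E : Type*} [AddCommGroup E] (A B : Set E) (x y : E) :
    (A ∩ ((· + x) '' B)).indicator (1 : E → ENNReal) y =
      A.indicator 1 y * B.indicator 1 (y - x) := by
  rw [Set.inter_indicator_one, Pi.mul_apply]
  congr 1
  rw [Set.image_add_right]
  rw [sub_eq_add_neg]
  rfl

theorem latCountD_mul_eq_tsum {d : ℕ} {A B : Set (Fin d → ℝ)} (hA : IsCompact A)
    (hB : IsCompact B) (x : Fin d → ℝ) :
    (latCountD d A x : ENNReal) * latCountD d B x =
      ∑' k : Fin d → ℤ, ∑' m : Fin d → ℤ,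
        (A ∩ ((· + fun i => (k i : ℝ)) '' B)).indicator 1 ((fun i => (m i : ℝ)) - x) := by
  rw [ENNReal.tsum_comm, latCountD_eq_tsum hA, latCountD_eq_tsum hB, ← ENNReal.tsum_mul_right]
  refine tsum_congr fun m => ?_
  rw [← (Equiv.subLeft m).tsum_eq, ← ENNReal.tsum_mul_left]
  refine tsum_congr fun k => ?_
  rw [inter_image_add_indicator]
  congr 2
  ext i
  simp only [Equiv.subLeft_apply, Pi.sub_apply, Int.cast_sub]
  ring

theorem integral_latCountD_mul {d : ℕ} {A B : Set (Fin d → ℝ)} (hA : IsCompact A)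
    (hB : IsCompact B) :
    ∫ x, (latCountD d A x : ℝ) * latCountD d B x ∂μcube d =
      ∑' m : Fin d → ℤ, crossCovariogram d A B (fun i => (m i : ℝ)) := by
  have hm : ∀ k : Fin d → ℤ, MeasurableSet (A ∩ ((· + fun i => (k i : ℝ)) '' B)) := fun k =>
    (hA.inter (hB.image (continuous_id.add continuous_const))).measurableSet
  rw [integral_eq_lintegral_of_nonneg_ae
    (Filter.Eventually.of_forall fun _ => mul_nonneg (Nat.cast_nonneg _) (Nat.cast_nonneg _))
    ((measurable_latCountD hA).mul (measurable_latCountD hB)).aestronglyMeasurable]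
  simp_rw [ENNReal.ofReal_mul (Nat.cast_nonneg _), ENNReal.ofReal_natCast,
    latCountD_mul_eq_tsum hA hB]
  rw [lintegral_tsum fun k => (Measurable.tsum fun m =>
    measurable_intCast_sub_indicator (hm k) m).aemeasurable]
  simp_rw [fun k => lintegral_μcube_tsum_sub d (measurable_one.indicator (hm k)),
    fun k => lintegral_indicator_one (μ := volume) (hm k)]
  exact ENNReal.tsum_toReal_eq fun k =>
    ((measure_mono Set.inter_subset_left).trans_lt hA.measure_lt_top).ne

theorem integral_crossCovariogram {d : ℕ} {A B : Set (Fin d → ℝ)} (hA : IsCompact A)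
    (hB : IsCompact B) :
    ∫ x, crossCovariogram d A B x = (volume A).toReal * (volume B).toReal := by
  have hprod : Measurable fun p : (Fin d → ℝ) × (Fin d → ℝ) =>
      A.indicator (1 : (Fin d → ℝ) → ENNReal) p.2 * B.indicator 1 (p.2 - p.1) :=
    ((measurable_one.indicator hA.measurableSet).comp measurable_snd).mul
      ((measurable_one.indicator hB.measurableSet).comp (measurable_snd.sub measurable_fst))
  have hvol : ∀ x : Fin d → ℝ, volume (A ∩ ((· + x) '' B)) =
      ∫⁻ y, A.indicator (1 : (Fin d → ℝ) → ENNReal) y * B.indicator 1 (y - x) := fun x => by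
    have hm : MeasurableSet (A ∩ ((· + x) '' B)) :=
      (hA.inter (hB.image (continuous_id.add continuous_const))).measurableSet
    rw [← lintegral_indicator_one hm]
    simp_rw [← inter_image_add_indicator]
  have hmeas : Measurable fun x : Fin d → ℝ => volume (A ∩ ((· + x) '' B)) := by
    simp_rw [hvol]
    exact hprod.lintegral_prod_right'
  unfold crossCovariogram
  rw [integral_toReal hmeas.aemeasurable (Filter.Eventually.of_forall fun x =>
    (measure_mono Set.inter_subset_left).trans_lt hA.measure_lt_top), ← ENNReal.toReal_mul]
  congr 1
  simp_rw [hvol]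
  rw [lintegral_lintegral_swap hprod.aemeasurable]
  have hinner : ∀ y : Fin d → ℝ,
      ∫⁻ x, A.indicator (1 : (Fin d → ℝ) → ENNReal) y * B.indicator 1 (y - x) =
        A.indicator 1 y * volume B := fun y => by
    have hm : Measurable fun x => B.indicator (1 : (Fin d → ℝ) → ENNReal) (y - x) :=
      (measurable_one.indicator hB.measurableSet).comp (measurable_const.sub measurable_id)
    rw [lintegral_const_mul _ hm, lintegral_sub_left_eq_self (B.indicator 1) y,
      lintegral_indicator_one hB.measurableSet]
  simp_rw [hinner]
  rw [lintegral_mul_const _ (measurable_one.indicator hA.measurableSet),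
    lintegral_indicator_one hA.measurableSet]

theorem integral_centered_latCountD_mul {d : ℕ} {A B : Set (Fin d → ℝ)} (hA : IsCompact A)
    (hB : IsCompact B) :
    ∫ x, ((latCountD d A x : ℝ) - ∫ y, (latCountD d A y : ℝ) ∂μcube d)
        * ((latCountD d B x : ℝ) - ∫ y, (latCountD d B y : ℝ) ∂μcube d) ∂μcube d
      = (∑' m : Fin d → ℤ, crossCovariogram d A B (fun i => (m i : ℝ)))
        - (volume A).toReal * (volume B).toReal := by
  have h := ProbabilityTheory.covariance_eq_sub (memLp_latCountD hA 2) (memLp_latCountD hB 2)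
  rw [ProbabilityTheory.covariance] at h
  rw [h, integral_latCountD hA, integral_latCountD hB, ← integral_latCountD_mul hA hB]
  rfl

/-- For compact sets `A, B ⊆ ℝ^d`, with `X_A, X_B` evaluated at the same
uniform point `X ∈ [0,1]^d`:
`cov(X_A, X_B) = ∑_{n ∈ ℤ^d} g_{A,B}(n) - ∫_{ℝ^d} g_{A,B}(x) dx
             = ∑_{n ∈ ℤ^d} g_{A,B}(n) - vol(A)·vol(B)`,
and in particular `Var(X_A) = ∑_{n ∈ ℤ^d} g_A(n) - ∫_{ℝ^d} g_A(x) dx`. -/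
theorem covariance_eq_covariogram_sum (d : ℕ) (A B : Set (Fin d → ℝ))
    (hA : IsCompact A) (hB : IsCompact B) :
    ((∫ x, ((latCountD d A x : ℝ) - ∫ y, (latCountD d A y : ℝ) ∂μcube d)
        * ((latCountD d B x : ℝ) - ∫ y, (latCountD d B y : ℝ) ∂μcube d) ∂μcube d)
      = (∑' m : Fin d → ℤ, crossCovariogram d A B (fun i => (m i : ℝ)))
        - ∫ x, crossCovariogram d A B x ∂volume) ∧
    ((∫ x, ((latCountD d A x : ℝ) - ∫ y, (latCountD d A y : ℝ) ∂μcube d)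
        * ((latCountD d B x : ℝ) - ∫ y, (latCountD d B y : ℝ) ∂μcube d) ∂μcube d)
      = (∑' m : Fin d → ℤ, crossCovariogram d A B (fun i => (m i : ℝ)))
        - (volume A).toReal * (volume B).toReal) ∧
    ((∫ x, ((latCountD d A x : ℝ) - ∫ y, (latCountD d A y : ℝ) ∂μcube d) ^ 2 ∂μcube d)
      = (∑' m : Fin d → ℤ, crossCovariogram d A A (fun i => (m i : ℝ)))
        - ∫ x, crossCovariogram d A A x ∂volume) := by
  refine ⟨?_, integral_centered_latCountD_mul hA hB, ?_⟩
  · rw [integral_crossCovariogram hA hB, integral_centered_latCountD_mul hA hB]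
  · simp_rw [pow_two]
    rw [integral_crossCovariogram hA hA, integral_centered_latCountD_mul hA hA]
end
end
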